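/- Let d ≥ 2, δ > 0, α > 0, and let Φ be a semiflow of the vector field F. Then, almost surely, the interpolated process z̄ of the two-particle vertex-reinforced interacting random walk is an asymptotic pseudotrajectory of Φ: for every T > 0, lim_{t→∞} sup_{0 ≤ h ≤ T} ‖z̄(t+h) − Φ_h(z̄(t))‖₁ = 0, where ‖·‖₁ is the L¹ norm on ℝ^{2d}. -/

import Mathlib

open MeasureTheory Filter Finset

/-- The closed simplex `Δ = {u : u_i ≥ 0, ∑ u_i = 1}`. -/
def simplexSet (d : ℕ) : Set (Fin d → ℝ) :=
  {u | (∀ i, 0 ≤ u i) ∧ ∑ i, u i = 1}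

/-- `D = Δ × Δ`. -/
def Dset (d : ℕ) : Set ((Fin d → ℝ) × (Fin d → ℝ)) :=
  {z | z.1 ∈ simplexSet d ∧ z.2 ∈ simplexSet d}

/-- `π_i(x) = f_δ(x_i)^{−α} / ∑_k f_δ(x_k)^{−α}` with `f_δ(x) = max(δ, x)`. -/
noncomputable def piv (d : ℕ) (δ α : ℝ) (x : Fin d → ℝ) (i : Fin d) : ℝ :=
  (max δ (x i)) ^ (-α) / ∑ k, (max δ (x k)) ^ (-α)

/-- The vector field `F(u,v) = (−u + π(v), −v + π(u))`. -/
noncomputable def Fvec (d : ℕ) (δ α : ℝ) (z : (Fin d → ℝ) × (Fin d → ℝ)) :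
    (Fin d → ℝ) × (Fin d → ℝ) :=
  (-z.1 + piv d δ α z.2, -z.2 + piv d δ α z.1)

/-- The `L¹` norm on `ℝ^{2d}`. -/
noncomputable def norm1 {d : ℕ} (z : (Fin d → ℝ) × (Fin d → ℝ)) : ℝ :=
  ∑ i, |z.1 i| + ∑ i, |z.2 i|

/-- A semiflow of the vector field `F` on `D`: a continuous map `Φ : [0,∞) × D → D` with
`Φ_0 = id`, `Φ_{t+s} = Φ_t ∘ Φ_s`, whose trajectories solve `ξ′ = F(ξ)` on `[0,∞)`. -/
noncomputable def IsSemiflow (d : ℕ) (δ α : ℝ)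
    (Φ : ℝ → ((Fin d → ℝ) × (Fin d → ℝ)) → ((Fin d → ℝ) × (Fin d → ℝ))) : Prop :=
  ContinuousOn (fun p : ℝ × ((Fin d → ℝ) × (Fin d → ℝ)) => Φ p.1 p.2)
      (Set.Ici 0 ×ˢ Dset d) ∧
    (∀ a ∈ Dset d, Φ 0 a = a) ∧
    (∀ a ∈ Dset d, ∀ t ≥ (0 : ℝ), Φ t a ∈ Dset d) ∧
    (∀ a ∈ Dset d, ∀ s ≥ (0 : ℝ), ∀ t ≥ (0 : ℝ), Φ (t + s) a = Φ t (Φ s a)) ∧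
    (∀ a ∈ Dset d, ∀ t ≥ (0 : ℝ),
      HasDerivWithinAt (fun s => Φ s a) (Fvec d δ α (Φ t a)) (Set.Ici 0) t)

/-- The empirical occupation measure: `occ d X n ω i = (1 + #{1 ≤ k ≤ n : X_k(ω) = i})/(n+d)`. -/
noncomputable def occ {Ω : Type} (d : ℕ) (X : ℕ → Ω → Fin d) (n : ℕ) (ω : Ω) (i : Fin d) : ℝ :=
  (1 + ((Finset.Icc 1 n).filter (fun k => X k ω = i)).card) / (n + d)

/-- The interpolation times `τ_0 = 0`, `τ_n = ∑_{k=1}^n 1/(k+d)`. -/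
noncomputable def tau (d : ℕ) (n : ℕ) : ℝ := ∑ k ∈ Finset.Icc 1 n, (1 : ℝ) / (k + d)

/-- `g` is the piecewise affine interpolation of the sequence `a` at the nodes `τ`. -/
def IsAffineInterpolation {E : Type*} [NormedAddCommGroup E] [NormedSpace ℝ E]
    (τ : ℕ → ℝ) (a : ℕ → E) (g : ℝ → E) : Prop :=
  ∀ n : ℕ, ∀ t ∈ Set.Icc (τ n) (τ (n + 1)),
    g t = a n + ((t - τ n) / (τ (n + 1) - τ n)) • (a (n + 1) - a n)

theorem exists_mem_Ico_of_tendsto_atTop {τ : ℕ → ℝ} (hτ : Tendsto τ atTop atTop) {t : ℝ}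
    (ht : τ 0 ≤ t) : ∃ n, t ∈ Set.Ico (τ n) (τ (n + 1)) := by
  classical
  have hex : ∃ n, t < τ (n + 1) :=
    ((tendsto_add_atTop_iff_nat 1).2 hτ |>.eventually_gt_atTop t).exists
  refine ⟨Nat.find hex, ?_, Nat.find_spec hex⟩
  rcases h : Nat.find hex with _ | k
  · exact ht
  · exact not_lt.1 (Nat.find_min hex (m := k) (by omega))

namespace IsAffineInterpolation

variable {E : Type*} [NormedAddCommGroup E] [NormedSpace ℝ E] {τ : ℕ → ℝ} {a b : ℕ → E}
  {g k : ℝ → E}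

theorem mem_segment (hg : IsAffineInterpolation τ a g) (hτ : StrictMono τ) {n : ℕ} {t : ℝ}
    (ht : t ∈ Set.Icc (τ n) (τ (n + 1))) : g t ∈ segment ℝ (a n) (a (n + 1)) := by
  have h : 0 < τ (n + 1) - τ n := sub_pos.2 (hτ n.lt_succ_self)
  rw [segment_eq_image', hg n t ht]
  exact ⟨_, ⟨div_nonneg (sub_nonneg.2 ht.1) h.le,
    (div_le_one h).2 (sub_le_sub_right ht.2 _)⟩, rfl⟩

theorem sub (hg : IsAffineInterpolation τ a g) (hk : IsAffineInterpolation τ b k) :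
    IsAffineInterpolation τ (fun n => a n - b n) (fun t => g t - k t) := by
  intro n t ht
  simp only [hg n t ht, hk n t ht, smul_sub]
  abel

theorem continuousOn (hg : IsAffineInterpolation τ a g) (hτ : StrictMono τ)
    (hτ' : Tendsto τ atTop atTop) : ContinuousOn g (Set.Ici (τ 0)) := by
  have key : ∀ n, ContinuousOn g (Set.Icc (τ 0) (τ n)) := by
    intro n
    induction n with
    | zero => simp
    | succ n ih =>
      rw [← Set.Icc_union_Icc_eq_Icc (hτ.monotone n.zero_le) (hτ n.lt_succ_self).le]
      refine ih.union_of_isClosed ?_ isClosed_Icc isClosed_Icc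
      refine ContinuousOn.congr (Continuous.continuousOn ?_) (hg n)
      fun_prop
  intro t ht
  obtain ⟨n, hn⟩ := (hτ'.eventually_gt_atTop t).exists
  refine ((key n) t ⟨ht, hn.le⟩).mono_of_mem_nhdsWithin ?_
  rw [← Set.Ici_inter_Iic]
  exact inter_mem_nhdsWithin _ (Iic_mem_nhds hn)

theorem hasDerivWithinAt (hg : IsAffineInterpolation τ a g) {n : ℕ} {t : ℝ}
    (ht : t ∈ Set.Ico (τ n) (τ (n + 1))) :
    HasDerivWithinAt g ((τ (n + 1) - τ n)⁻¹ • (a (n + 1) - a n)) (Set.Ici t) t := by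
  have h : HasDerivAt
      (fun t => a n + ((t - τ n) / (τ (n + 1) - τ n)) • (a (n + 1) - a n))
      ((τ (n + 1) - τ n)⁻¹ • (a (n + 1) - a n)) t := by
    have h1 : HasDerivAt (fun t => (t - τ n) / (τ (n + 1) - τ n)) (τ (n + 1) - τ n)⁻¹ t := by
      simpa using ((hasDerivAt_id t).sub_const (τ n)).div_const (τ (n + 1) - τ n)
    exact (h1.smul_const _).const_add _
  refine h.hasDerivWithinAt.congr_of_eventuallyEq ?_ (hg n t ⟨ht.1, ht.2.le⟩)
  filter_upwards [Icc_mem_nhdsGE ht.2] with s hs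
  exact hg n s ⟨ht.1.trans hs.1, hs.2⟩

theorem norm_sub_le (hg : IsAffineInterpolation τ a g) (hτ : StrictMono τ) {n : ℕ} {t : ℝ}
    (ht : t ∈ Set.Icc (τ n) (τ (n + 1))) : ‖a n - g t‖ ≤ ‖a (n + 1) - a n‖ := by
  have h : 0 < τ (n + 1) - τ n := sub_pos.2 (hτ n.lt_succ_self)
  rw [hg n t ht, sub_add_cancel_left, norm_neg, norm_smul, Real.norm_of_nonneg
    (div_nonneg (sub_nonneg.2 ht.1) h.le)]
  exact mul_le_of_le_one_left (norm_nonneg _) ((div_le_one h).2 (sub_le_sub_right ht.2 _))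

theorem mem_of_convex (hg : IsAffineInterpolation τ a g) (hτ : StrictMono τ)
    (hτ' : Tendsto τ atTop atTop) {s : Set E} (hs : Convex ℝ s) {N : ℕ}
    (ha : ∀ n ≥ N, a n ∈ s) {t : ℝ} (ht : τ N ≤ t) : g t ∈ s := by
  obtain ⟨n, hn⟩ := exists_mem_Ico_of_tendsto_atTop hτ'
    ((hτ.monotone N.zero_le).trans ht)
  have hN : N ≤ n := Nat.lt_succ_iff.1 (hτ.lt_iff_lt.1 (ht.trans_lt hn.2))
  exact hs.segment_subset (ha n hN) (ha _ (hN.trans n.le_succ))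
    (hg.mem_segment hτ ⟨hn.1, hn.2.le⟩)

end IsAffineInterpolation

theorem exists_isAffineInterpolation {E : Type*} [NormedAddCommGroup E] [NormedSpace ℝ E]
    {τ : ℕ → ℝ} (hτ : StrictMono τ) (hτ' : Tendsto τ atTop atTop) (a : ℕ → E) :
    ∃ g, IsAffineInterpolation τ a g := by
  have hidx : ∀ t : ℝ, ∃ n, τ 0 ≤ t → t ∈ Set.Ico (τ n) (τ (n + 1)) := fun t => by
    by_cases ht : τ 0 ≤ t
    · exact (exists_mem_Ico_of_tendsto_atTop hτ' ht).imp fun _ h _ => h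
    · exact ⟨0, fun h => absurd h ht⟩
  choose ν hν using hidx
  refine ⟨fun t => a (ν t) + ((t - τ (ν t)) / (τ (ν t + 1) - τ (ν t))) •
    (a (ν t + 1) - a (ν t)), fun n t ht => ?_⟩
  have hmem := hν t ((hτ.monotone n.zero_le).trans ht.1)
  rcases ht.2.lt_or_eq with hlt | rfl
  · have h1 := hτ.lt_iff_lt.1 (hmem.1.trans_lt hlt)
    have h2 := hτ.lt_iff_lt.1 (ht.1.trans_lt hmem.2)
    obtain h : ν t = n := by omega
    simp only [h]
  · have h1 := hτ.le_iff_le.1 hmem.1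
    have h2 := hτ.lt_iff_lt.1 hmem.2
    obtain h : ν (τ (n + 1)) = n + 1 := by omega
    have h3 : τ (n + 1) - τ n ≠ 0 := (sub_pos.2 (hτ n.lt_succ_self)).ne'
    simp [h, div_self h3]

/-- An Euler scheme with vanishing steps for a Lipschitz vector field, perturbed by noise whose
partial sums converge, shadows the trajectories of the vector field on bounded time intervals. -/
theorem exists_forall_norm_sub_trajectory_le {E : Type*} [NormedAddCommGroup E]
    [NormedSpace ℝ E] {τ : ℕ → ℝ} (hτ : StrictMono τ) (hτ' : Tendsto τ atTop atTop)
    {z M : ℕ → E} {v : E → E} {K : NNReal} (hv : LipschitzWith K v)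
    (hstep : ∀ n, z (n + 1) - z n = (τ (n + 1) - τ n) • v (z n) + (M (n + 1) - M n))
    (hz : Tendsto (fun n => z (n + 1) - z n) atTop (nhds 0))
    {m : E} (hM : Tendsto M atTop (nhds m)) {zbar : ℝ → E}
    (hzbar : IsAffineInterpolation τ z zbar) {T ε : ℝ} (hε : 0 < ε) :
    ∃ t₀, ∀ t ≥ t₀, ∀ φ : ℝ → E, φ 0 = zbar t → ContinuousOn φ (Set.Icc 0 T) →
      (∀ s ∈ Set.Ico 0 T, HasDerivWithinAt φ (v (φ s)) (Set.Ici s) s) →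
      ∀ h ∈ Set.Icc 0 T, ‖zbar (t + h) - φ h‖ ≤ ε := by
  obtain ⟨η, hη, hηε⟩ : ∃ η > 0, gronwallBound 0 K (2 * K * η) T + η ≤ ε := by
    have hc : Continuous fun η : ℝ => gronwallBound 0 K (2 * K * η) T + η :=
      ((gronwallBound_continuous_ε 0 K T).comp (continuous_const.mul continuous_id)).add
        continuous_id
    have h0 : Tendsto (fun η : ℝ => gronwallBound 0 K (2 * K * η) T + η) (nhds 0) (nhds 0) := by
      simpa [gronwallBound_ε0_δ0] using hc.tendsto 0
    have h1 := h0.mono_left (nhdsWithin_le_nhds (s := Set.Ioi 0))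
    obtain ⟨η, hη⟩ := ((h1.eventually (Iic_mem_nhds hε)).and self_mem_nhdsWithin).exists
    exact ⟨η, hη.2, hη.1⟩
  obtain ⟨Mbar, hMbar⟩ := exists_isAffineInterpolation hτ hτ' M
  obtain ⟨N, hN⟩ := eventually_atTop.1 ((hz.eventually (Metric.closedBall_mem_nhds _ hη)).and
    (hM.eventually (Metric.closedBall_mem_nhds _ (half_pos hη))))
  refine ⟨τ N, fun t ht φ hφ0 hφc hφ' h hh => ?_⟩
  have ht0 : τ 0 ≤ t := (hτ.monotone N.zero_le).trans ht
  have hMm : ∀ s ≥ 0, ‖Mbar (t + s) - Mbar t‖ ≤ η := by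
    intro s hs
    have h1 : ∀ r ≥ τ N, Mbar r ∈ Metric.closedBall m (η / 2) := fun r hr =>
      hMbar.mem_of_convex hτ hτ' (convex_closedBall _ _) (fun n hn => (hN n hn).2) hr
    rw [← dist_eq_norm]
    calc _ ≤ _ := dist_triangle_right _ _ m
      _ ≤ η / 2 + η / 2 := add_le_add (h1 _ (by linarith)) (h1 _ ht)
      _ = η := add_halves η
  set f : ℝ → E := fun s => (zbar (t + s) - Mbar (t + s)) + Mbar t with hf
  have hW := hzbar.sub hMbar
  have hidx : ∀ s : ℝ, ∃ n, 0 ≤ s → t + s ∈ Set.Ico (τ n) (τ (n + 1)) := fun s => by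
    by_cases hs : 0 ≤ s
    · exact (exists_mem_Ico_of_tendsto_atTop hτ' (by linarith)).imp fun _ h _ => h
    · exact ⟨0, fun h => absurd h hs⟩
  choose ν hν using hidx
  have hfc : ContinuousOn f (Set.Icc 0 T) := by
    refine ContinuousOn.add (ContinuousOn.comp (hW.continuousOn hτ hτ')
      (by fun_prop) fun s hs => ?_) continuousOn_const
    simp only [Set.mem_Ici]
    linarith [hs.1]
  have hf' : ∀ s ∈ Set.Ico 0 T, HasDerivWithinAt f (v (z (ν s))) (Set.Ici s) s := by
    intro s hs
    have h1 := hW.hasDerivWithinAt (hν s hs.1)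
    have h2 : (τ (ν s + 1) - τ (ν s))⁻¹ •
        ((z (ν s + 1) - M (ν s + 1)) - (z (ν s) - M (ν s))) = v (z (ν s)) := by
      have h3 : τ (ν s + 1) - τ (ν s) ≠ 0 := (sub_pos.2 (hτ (ν s).lt_succ_self)).ne'
      rw [sub_sub_sub_comm, hstep, add_sub_cancel_right, inv_smul_smul₀ h3]
    rw [h2] at h1
    have h4 : HasDerivWithinAt (fun s : ℝ => t + s) 1 (Set.Ici s) s :=
      ((hasDerivAt_id s).const_add t).hasDerivWithinAt
    have := (h1.scomp s h4 (fun r hr => by simpa using hr)).add_const (Mbar t)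
    rwa [one_smul] at this
  have hfb : ∀ s ∈ Set.Ico 0 T, dist (v (z (ν s))) (v (f s)) ≤ 2 * K * η := by
    intro s hs
    have hmem := hν s hs.1
    have hNn : N ≤ ν s := Nat.lt_succ_iff.1 (hτ.lt_iff_lt.1
      ((ht.trans (by linarith [hs.1])).trans_lt hmem.2))
    have h1 : ‖z (ν s) - zbar (t + s)‖ ≤ η :=
      (hzbar.norm_sub_le hτ ⟨hmem.1, hmem.2.le⟩).trans (by simpa using (hN _ hNn).1)
    have h2 : dist (z (ν s)) (f s) ≤ η + η := by
      have : z (ν s) - f s = (z (ν s) - zbar (t + s)) + (Mbar (t + s) - Mbar t) := by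
        simp only [hf]; abel
      rw [dist_eq_norm, this]
      exact (norm_add_le _ _).trans (add_le_add h1 (hMm s hs.1))
    calc _ ≤ K * dist (z (ν s)) (f s) := hv.dist_le_mul _ _
      _ ≤ K * (η + η) := by gcongr
      _ = 2 * K * η := by ring
  have hgr := dist_le_of_approx_trajectories_ODE (v := fun _ => v) (δ := 0) (εg := 0)
    (fun _ => hv) hfc hf' hfb hφc hφ' (fun s _ => (dist_self _).le)
    (by simp [hf, hφ0]) h hh
  rw [add_zero, sub_zero, dist_eq_norm] at hgr
  have hmono : gronwallBound 0 K (2 * K * η) h ≤ gronwallBound 0 K (2 * K * η) T :=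
    gronwallBound_mono le_rfl (by positivity) K.2 hh.2
  have hsplit : zbar (t + h) - φ h = (f h - φ h) + (Mbar (t + h) - Mbar t) := by
    simp only [hf]; abel
  rw [hsplit]
  linarith [norm_add_le (f h - φ h) (Mbar (t + h) - Mbar t), hMm h hh.1]

/-- A series of uniformly bounded martingale differences with square summable weights
converges almost surely. -/
theorem ae_exists_tendsto_sum_mul_of_condExp_eq_zero {Ω : Type*} {mΩ : MeasurableSpace Ω}
    {P : Measure Ω} [IsProbabilityMeasure P] {ℱ : Filtration ℕ mΩ} {γ : ℕ → ℝ}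
    (hγ : Summable fun n => γ n ^ 2) {U : ℕ → Ω → ℝ}
    (hU : ∀ n, StronglyMeasurable[ℱ (n + 1)] (U n)) (hb : ∀ n ω, |U n ω| ≤ 1)
    (hc : ∀ n, P[U n | ℱ n] =ᵐ[P] 0) :
    ∀ᵐ ω ∂P, ∃ m, Tendsto (fun n => ∑ k ∈ range n, γ k * U k ω) atTop (nhds m) := by
  set S : ℕ → Ω → ℝ := fun n ω => ∑ k ∈ range n, γ k * U k ω with hS
  have hSm : ∀ n, StronglyMeasurable[ℱ n] (S n) := fun n =>
    Finset.stronglyMeasurable_fun_sum _ fun k hk =>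
      ((hU k).mono (ℱ.mono (Finset.mem_range.1 hk))).const_mul _
  have hSb : ∀ n ω, ‖S n ω‖ ≤ ∑ k ∈ range n, |γ k| := fun n ω =>
    (Finset.abs_sum_le_sum_abs _ _).trans <| Finset.sum_le_sum fun k _ => by
      rw [abs_mul]; exact mul_le_of_le_one_right (abs_nonneg _) (hb k ω)
  have hSi : ∀ n, Integrable (S n) P := fun n =>
    .of_bound ((hSm n).mono (ℱ.le n)).aestronglyMeasurable _ (ae_of_all _ (hSb n))
  have hUi : ∀ n, Integrable (U n) P := fun n =>
    .of_bound ((hU n).mono (ℱ.le _)).aestronglyMeasurable 1 (ae_of_all _ (hb n))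
  have hsucc : ∀ n ω, S (n + 1) ω = S n ω + γ n * U n ω := fun n ω =>
    Finset.sum_range_succ _ _
  have hmart : Martingale S ℱ P := by
    refine martingale_of_condExp_sub_eq_zero_nat hSm hSi fun n => ?_
    have h1 : S (n + 1) - S n = γ n • U n := by
      ext ω; simp [hsucc]
    rw [h1]
    filter_upwards [condExp_smul (μ := P) (γ n) (U n) (ℱ n), hc n] with ω h2 h3
    simp [h2, h3]
  have hSUi : ∀ n, Integrable (S n * U n) P := fun n =>
    (hUi n).bdd_mul (((hSm n).mono (ℱ.le n)).aestronglyMeasurable) (ae_of_all _ (hSb n))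
  have horth : ∀ n, ∫ ω, S n ω * U n ω ∂P = 0 := fun n => by
    rw [← integral_condExp (ℱ.le n)]
    refine integral_eq_zero_of_ae ?_
    filter_upwards [condExp_mul_of_stronglyMeasurable_left (hSm n) (hSUi n) (hUi n), hc n]
      with ω h1 h2
    have : P[fun ω => S n ω * U n ω | ℱ n] ω = (S n * P[U n | ℱ n]) ω := h1
    simp [this, h2]
  have hsqi : ∀ {V : Ω → ℝ} (c : ℝ), Integrable V P → (∀ ω, ‖V ω‖ ≤ c) →
      Integrable (fun ω => V ω ^ 2) P := fun c hV hc => by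
    simpa only [pow_two] using hV.bdd_mul hV.1 (ae_of_all _ hc)
  have hsq : ∀ n, ∫ ω, S n ω ^ 2 ∂P ≤ ∑ k ∈ range n, γ k ^ 2 := by
    intro n
    induction n with
    | zero => simp [hS]
    | succ n ih =>
      have h1 : ∫ ω, U n ω ^ 2 ∂P ≤ 1 := by
        calc _ ≤ ∫ _, (1 : ℝ) ∂P := integral_mono (hsqi 1 (hUi n) (hb n))
              (integrable_const _) fun ω => (sq_le_one_iff_abs_le_one _).2 (hb n ω)
          _ = 1 := by simp
      have hA := hsqi _ (hSi n) (hSb n)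
      have hB := (hSUi n).const_mul (2 * γ n)
      have hAB : Integrable (fun ω => S n ω ^ 2 + 2 * γ n * (S n * U n) ω) P := hA.add hB
      have hC := (hsqi 1 (hUi n) (hb n)).const_mul (γ n ^ 2)
      calc ∫ ω, S (n + 1) ω ^ 2 ∂P
          = ∫ ω, (S n ω ^ 2 + 2 * γ n * (S n * U n) ω) + γ n ^ 2 * U n ω ^ 2 ∂P := by
            refine integral_congr_ae (ae_of_all _ fun ω => ?_)
            simp only [hsucc, Pi.mul_apply]; ring
        _ = ∫ ω, S n ω ^ 2 ∂P + γ n ^ 2 * ∫ ω, U n ω ^ 2 ∂P := by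
            rw [integral_add hAB hC, integral_add hA hB, integral_const_mul,
              integral_const_mul]
            simp [horth]
        _ ≤ ∑ k ∈ range (n + 1), γ k ^ 2 := by
            rw [Finset.sum_range_succ]
            exact add_le_add ih (mul_le_of_le_one_right (sq_nonneg _) h1)
  have hL1 : ∀ n, eLpNorm (S n) 1 P ≤ (Real.toNNReal (1 + ∑' k, γ k ^ 2) : NNReal) := by
    intro n
    rw [eLpNorm_one_eq_lintegral_enorm, ← ofReal_integral_norm_eq_lintegral_enorm (hSi n)]
    refine ENNReal.ofReal_le_ofReal ?_
    calc ∫ ω, ‖S n ω‖ ∂P ≤ ∫ ω, (1 + S n ω ^ 2) ∂P :=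
          integral_mono (hSi n).norm ((integrable_const _).add (hsqi _ (hSi n) (hSb n)))
            fun ω => by
              simp only [Real.norm_eq_abs]
              nlinarith [sq_abs (S n ω), sq_nonneg (|S n ω| - 1)]
      _ = 1 + ∫ ω, S n ω ^ 2 ∂P := by
          rw [integral_add (integrable_const _) (hsqi _ (hSi n) (hSb n))]; simp
      _ ≤ _ := by
          gcongr
          exact (hsq n).trans (hγ.sum_le_tsum _ fun _ _ => sq_nonneg _)
  filter_upwards [hmart.submartingale.ae_tendsto_limitProcess hL1] with ω hω
  exact ⟨_, hω⟩

theorem piv_nonneg {d : ℕ} {δ : ℝ} (hδ : 0 < δ) (α : ℝ) (x : Fin d → ℝ) (i : Fin d) :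
    0 ≤ piv d δ α x i := by
  have h : ∀ k, 0 < max δ (x k) := fun k => hδ.trans_le (le_max_left _ _)
  exact div_nonneg (Real.rpow_nonneg (h i).le _)
    (Finset.sum_nonneg fun k _ => Real.rpow_nonneg (h k).le _)

theorem sum_rpow_max_pos {d : ℕ} [NeZero d] {δ : ℝ} (hδ : 0 < δ) (α : ℝ) (x : Fin d → ℝ) :
    0 < ∑ k, (max δ (x k)) ^ (-α) :=
  Finset.sum_pos (fun _ _ => Real.rpow_pos_of_pos (hδ.trans_le (le_max_left _ _)) _)
    Finset.univ_nonempty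

theorem sum_piv {d : ℕ} [NeZero d] {δ : ℝ} (hδ : 0 < δ) (α : ℝ) (x : Fin d → ℝ) :
    ∑ i, piv d δ α x i = 1 := by
  simp only [piv]
  rw [← Finset.sum_div, div_self (sum_rpow_max_pos hδ α x).ne']

theorem piv_le_one {d : ℕ} [NeZero d] {δ : ℝ} (hδ : 0 < δ) (α : ℝ) (x : Fin d → ℝ)
    (i : Fin d) : piv d δ α x i ≤ 1 := by
  rw [← sum_piv hδ α x]
  exact Finset.single_le_sum (fun k _ => piv_nonneg hδ α x k) (Finset.mem_univ i)

theorem rpow_max_le_exp_mul {δ α : ℝ} (hδ : 0 < δ) (hα : 0 < α) {s t η : ℝ}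
    (h : |s - t| ≤ η) :
    (max δ t) ^ (-α) ≤ Real.exp (α / δ * η) * (max δ s) ^ (-α) := by
  have hs : 0 < max δ s := hδ.trans_le (le_max_left _ _)
  have ht : 0 < max δ t := hδ.trans_le (le_max_left _ _)
  have hη : 0 ≤ η := (abs_nonneg _).trans h
  have h1 : max δ s ≤ Real.exp (η / δ) * max δ t := by
    have h2 : max δ s ≤ max δ t + η := by
      refine max_le ?_ ?_
      · linarith [le_max_left δ t]
      · linarith [le_max_right δ t, (abs_le.1 h).2]
    have h3 : η ≤ η / δ * max δ t := by
      rw [div_mul_eq_mul_div, le_div_iff₀ hδ]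
      exact mul_le_mul_of_nonneg_left (le_max_left _ _) hη
    have h4 : (η / δ + 1) * max δ t ≤ Real.exp (η / δ) * max δ t :=
      mul_le_mul_of_nonneg_right (Real.add_one_le_exp _) ht.le
    linarith
  have h5 : (max δ s) ^ α ≤ Real.exp (α / δ * η) * (max δ t) ^ α := by
    calc (max δ s) ^ α ≤ (Real.exp (η / δ) * max δ t) ^ α :=
          Real.rpow_le_rpow hs.le h1 hα.le
      _ = _ := by
          rw [Real.mul_rpow (Real.exp_pos _).le ht.le, ← Real.exp_mul]
          ring_nf
  rw [Real.rpow_neg hs.le, Real.rpow_neg ht.le, ← div_eq_mul_inv,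
    inv_le_iff_one_le_mul₀ (Real.rpow_pos_of_pos ht _), div_mul_eq_mul_div,
    one_le_div (Real.rpow_pos_of_pos hs _)]
  exact h5

theorem piv_le_exp_mul {d : ℕ} [NeZero d] {δ α : ℝ} (hδ : 0 < δ) (hα : 0 < α)
    (x y : Fin d → ℝ) (i : Fin d) :
    piv d δ α x i ≤ Real.exp (2 * (α / δ) * ‖x - y‖) * piv d δ α y i := by
  have hxy : ∀ k, |x k - y k| ≤ ‖x - y‖ := fun k => norm_le_pi_norm (x - y) k
  have hyx : ∀ k, |y k - x k| ≤ ‖x - y‖ := fun k => abs_sub_comm (x k) (y k) ▸ hxy k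
  have h1 := rpow_max_le_exp_mul hδ hα (hyx i)
  have h2 : ∑ k, (max δ (y k)) ^ (-α) ≤
      Real.exp (α / δ * ‖x - y‖) * ∑ k, (max δ (x k)) ^ (-α) := by
    rw [Finset.mul_sum]
    exact Finset.sum_le_sum fun k _ => rpow_max_le_exp_mul hδ hα (hxy k)
  have hx := sum_rpow_max_pos hδ α x
  have hy := sum_rpow_max_pos hδ α y
  have hyi : 0 ≤ (max δ (y i)) ^ (-α) := Real.rpow_nonneg (hδ.le.trans (le_max_left _ _)) _
  have he : Real.exp (2 * (α / δ) * ‖x - y‖) =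
      Real.exp (α / δ * ‖x - y‖) * Real.exp (α / δ * ‖x - y‖) := by
    rw [← Real.exp_add]; ring_nf
  simp only [piv]
  rw [he, ← mul_div_assoc, div_le_div_iff₀ hx hy]
  calc _ ≤ (Real.exp (α / δ * ‖x - y‖) * (max δ (y i)) ^ (-α)) *
        (Real.exp (α / δ * ‖x - y‖) * ∑ k, (max δ (x k)) ^ (-α)) := by gcongr
    _ = _ := by ring

theorem piv_sub_le {d : ℕ} [NeZero d] {δ α : ℝ} (hδ : 0 < δ) (hα : 0 < α)
    (x y : Fin d → ℝ) (i : Fin d) :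
    piv d δ α x i - piv d δ α y i ≤ 2 * (α / δ) * ‖x - y‖ := by
  set u := 2 * (α / δ) * ‖x - y‖ with hu
  have hu0 : 0 ≤ u := by positivity
  have h := piv_le_exp_mul hδ hα x y i
  rw [← hu] at h
  have h1 : Real.exp (-u) * piv d δ α x i ≤ piv d δ α y i := by
    rw [Real.exp_neg, inv_mul_le_iff₀ (Real.exp_pos _)]
    exact h
  have h2 : 1 - u ≤ Real.exp (-u) := by linarith [Real.add_one_le_exp (-u)]
  nlinarith [mul_le_mul_of_nonneg_right h2 (piv_nonneg hδ α x i),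
    mul_le_mul_of_nonneg_left (piv_le_one hδ α x i) hu0]

theorem norm_piv_sub_le {d : ℕ} [NeZero d] {δ α : ℝ} (hδ : 0 < δ) (hα : 0 < α)
    (x y : Fin d → ℝ) :
    ‖piv d δ α x - piv d δ α y‖ ≤ 2 * (α / δ) * ‖x - y‖ := by
  refine (pi_norm_le_iff_of_nonneg (by positivity)).2 fun i => ?_
  rw [Pi.sub_apply, Real.norm_eq_abs, abs_sub_le_iff]
  exact ⟨piv_sub_le hδ hα x y i, norm_sub_rev x y ▸ piv_sub_le hδ hα y x i⟩

theorem lipschitzWith_Fvec {d : ℕ} [NeZero d] {δ α : ℝ} (hδ : 0 < δ) (hα : 0 < α) :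
    LipschitzWith (Real.toNNReal (1 + 2 * (α / δ))) (Fvec d δ α) := by
  have hK : 0 ≤ 1 + 2 * (α / δ) := by positivity
  have key : ∀ u u' v v' : Fin d → ℝ, ∀ r, ‖u - u'‖ ≤ r → ‖v - v'‖ ≤ r →
      ‖(-u + piv d δ α v) - (-u' + piv d δ α v')‖ ≤ (1 + 2 * (α / δ)) * r := by
    intro u u' v v' r h1 h2
    have h3 : (-u + piv d δ α v) - (-u' + piv d δ α v') =
      -(u - u') + (piv d δ α v - piv d δ α v') := by abel
    have h4 : 2 * (α / δ) * ‖v - v'‖ ≤ 2 * (α / δ) * r := by gcongr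
    rw [h3]
    refine (norm_add_le _ _).trans ?_
    rw [norm_neg]
    linarith [norm_piv_sub_le hδ hα v v']
  refine LipschitzWith.of_dist_le_mul fun z w => ?_
  rw [Real.coe_toNNReal _ hK, dist_eq_norm, dist_eq_norm]
  exact norm_prod_le_iff.2 ⟨key _ _ _ _ _ (norm_fst_le (z - w)) (norm_snd_le (z - w)),
    key _ _ _ _ _ (norm_snd_le (z - w)) (norm_fst_le (z - w))⟩

theorem occ_succ_sub {Ω : Type} {d : ℕ} [NeZero d] (X : ℕ → Ω → Fin d) (n : ℕ) (ω : Ω)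
    (i : Fin d) : occ d X (n + 1) ω i - occ d X n ω i =
      1 / (((n + 1 : ℕ) : ℝ) + d) * ((if X (n + 1) ω = i then 1 else 0) - occ d X n ω i) := by
  have hd : (0 : ℝ) < d := Nat.cast_pos.2 (NeZero.pos d)
  have h1 : (n : ℝ) + d ≠ 0 := by positivity
  have h2 : (n : ℝ) + 1 + d ≠ 0 := by positivity
  have hcard : (((Finset.Icc 1 (n + 1)).filter (fun k => X k ω = i)).card : ℝ) =
      ((Finset.Icc 1 n).filter (fun k => X k ω = i)).card +
        (if X (n + 1) ω = i then 1 else 0) := by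
    simp only [Finset.card_filter]
    push_cast
    rw [Finset.sum_Icc_succ_top (by omega)]
  simp only [occ, hcard]
  push_cast
  field_simp
  ring

theorem occ_mem_simplexSet {Ω : Type} {d : ℕ} [NeZero d] (X : ℕ → Ω → Fin d) (n : ℕ) (ω : Ω) :
    occ d X n ω ∈ simplexSet d := by
  have hd : (0 : ℝ) < d := Nat.cast_pos.2 (NeZero.pos d)
  refine ⟨fun i => by simp only [occ]; positivity, ?_⟩
  simp only [occ]
  have h1 : ∑ i, ((((Finset.Icc 1 n).filter (fun k => X k ω = i)).card : ℕ) : ℝ) = n := by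
    rw [← Nat.cast_sum, ← Finset.card_eq_sum_card_fiberwise
      (f := fun k => X k ω) (t := Finset.univ) (by simp)]
    simp
  rw [← Finset.sum_div, Finset.sum_add_distrib, h1]
  have h2 : (n : ℝ) + d ≠ 0 := by positivity
  simp [add_comm (d : ℝ), div_self h2]

theorem le_one_of_mem_simplexSet {d : ℕ} {u : Fin d → ℝ} (hu : u ∈ simplexSet d) (i : Fin d) :
    u i ≤ 1 :=
  hu.2 ▸ Finset.single_le_sum (fun k _ => hu.1 k) (Finset.mem_univ i)

theorem convex_simplexSet (d : ℕ) : Convex ℝ (simplexSet d) :=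
  convex_stdSimplex ℝ (Fin d)

theorem convex_Dset (d : ℕ) : Convex ℝ (Dset d) :=
  (convex_simplexSet d).prod (convex_simplexSet d)

theorem tau_succ_sub (d n : ℕ) : tau d (n + 1) - tau d n = 1 / (((n + 1 : ℕ) : ℝ) + d) := by
  simp only [tau]
  rw [Finset.sum_Icc_succ_top (by omega), add_sub_cancel_left]

theorem strictMono_tau (d : ℕ) : StrictMono (tau d) :=
  strictMono_nat_of_lt_succ fun n => sub_pos.1 (by rw [tau_succ_sub]; positivity)

theorem tendsto_one_div_add (d : ℕ) :
    Tendsto (fun n : ℕ => 1 / (((n + 1 : ℕ) : ℝ) + d)) atTop (nhds 0) := by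
  have h := (tendsto_add_atTop_iff_nat (f := fun n : ℕ => (1 : ℝ) / n) (1 + d)).2
    tendsto_one_div_atTop_nhds_zero_nat
  refine h.congr fun n => ?_
  push_cast
  ring_nf

theorem summable_sq_one_div_add (d : ℕ) :
    Summable fun n : ℕ => (1 / (((n + 1 : ℕ) : ℝ) + d)) ^ 2 := by
  have h := (summable_nat_add_iff (f := fun n : ℕ => 1 / (n : ℝ) ^ 2) (1 + d)).2
    (Real.summable_one_div_nat_pow.2 one_lt_two)
  refine h.congr fun n => ?_
  push_cast
  rw [div_pow, one_pow]
  ring_nf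

theorem tendsto_tau (d : ℕ) : Tendsto (tau d) atTop atTop := by
  have hns : ¬ Summable fun n : ℕ => 1 / (((n + 1 : ℕ) : ℝ) + d) := fun h =>
    Real.not_summable_one_div_natCast <|
      (summable_nat_add_iff (f := fun n : ℕ => 1 / (n : ℝ)) (1 + d)).1 <| h.congr fun n => by
        push_cast; ring_nf
  have h := (not_summable_iff_tendsto_nat_atTop_of_nonneg fun n => by positivity).1 hns
  refine h.congr fun n => ?_
  simp only [tau]
  rw [Finset.range_eq_Ico, Finset.sum_Ico_add' (fun k : ℕ => 1 / ((k : ℝ) + d)) 0 n 1]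
  rfl

theorem norm1_le {d : ℕ} (z : (Fin d → ℝ) × (Fin d → ℝ)) : norm1 z ≤ 2 * d * ‖z‖ := by
  have h1 : ∀ u : Fin d → ℝ, ‖u‖ ≤ ‖z‖ → ∑ i, |u i| ≤ d * ‖z‖ := fun u hu => by
    have := Finset.sum_le_card_nsmul Finset.univ (fun i => |u i|) ‖z‖
      fun i _ => (norm_le_pi_norm u i).trans hu
    simpa using this
  have := h1 _ (norm_fst_le z)
  have := h1 _ (norm_snd_le z)
  simp only [norm1]
  linarith

theorem norm1_nonneg {d : ℕ} (z : (Fin d → ℝ) × (Fin d → ℝ)) : 0 ≤ norm1 z := by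
  simp only [norm1]; positivity

theorem measurable_occ {Ω : Type} {mΩ : MeasurableSpace Ω} {d : ℕ} [NeZero d]
    {ℱ : Filtration ℕ mΩ} {X : ℕ → Ω → Fin d} (hX : ∀ n, Measurable[ℱ n] (X n)) (n : ℕ)
    (i : Fin d) : Measurable[ℱ n] fun ω => occ d X n ω i := by
  induction n with
  | zero => simp [occ]
  | succ n ih =>
    have h1 : (fun ω => occ d X (n + 1) ω i) = fun ω => occ d X n ω i +
        1 / (((n + 1 : ℕ) : ℝ) + d) *
          ((if X (n + 1) ω = i then 1 else 0) - occ d X n ω i) := by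
      ext ω
      rw [← occ_succ_sub, add_sub_cancel]
    have h2 := ih.mono (ℱ.mono n.le_succ) le_rfl
    have h3 : Measurable[ℱ (n + 1)] fun ω => if X (n + 1) ω = i then (1 : ℝ) else 0 :=
      (measurable_of_finite fun k : Fin d => if k = i then (1 : ℝ) else 0).comp (hX (n + 1))
    rw [h1]
    exact h2.add ((h3.sub h2).const_mul _)

theorem measurable_piv (d : ℕ) (δ α : ℝ) (i : Fin d) :
    Measurable fun x : Fin d → ℝ => piv d δ α x i := by
  simp only [piv]
  fun_prop

/-- The conditional law of the next position of one walker is `π` of the occupation measure of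
the other one, so its noise, summed with the weights `1 / (n + 1 + d)`, converges. -/
theorem ae_exists_tendsto_noise {d : ℕ} [NeZero d] {δ α : ℝ} (hδ : 0 < δ)
    {Ω : Type} {mΩ : MeasurableSpace Ω} {P : Measure Ω} [IsProbabilityMeasure P]
    {ℱ : Filtration ℕ mΩ} {X Y : ℕ → Ω → Fin d}
    (hX : ∀ n, Measurable[ℱ n] (X n)) (hY : ∀ n, Measurable[ℱ n] (Y n))
    (hcond : ∀ (n : ℕ) (i j : Fin d),
      (P[(fun ω => (if X (n + 1) ω = i then (1 : ℝ) else 0) *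
            (if Y (n + 1) ω = j then (1 : ℝ) else 0)) | ℱ n]) =ᵐ[P]
        fun ω => piv d δ α (occ d Y n ω) i * piv d δ α (occ d X n ω) j) :
    ∀ᵐ ω ∂P, ∃ m, Tendsto (fun n => fun i => ∑ k ∈ range n, 1 / (((k + 1 : ℕ) : ℝ) + d) *
      ((if X (k + 1) ω = i then (1 : ℝ) else 0) - piv d δ α (occ d Y k ω) i)) atTop (nhds m) := by
  have hind : ∀ {Z : ℕ → Ω → Fin d}, (∀ n, Measurable[ℱ n] (Z n)) → ∀ n i,
      Measurable[ℱ n] fun ω => if Z n ω = i then (1 : ℝ) else 0 := fun hZ n i =>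
    (measurable_of_finite fun k : Fin d => if k = i then (1 : ℝ) else 0).comp (hZ n)
  have hpm : ∀ n i, Measurable[ℱ n] fun ω => piv d δ α (occ d Y n ω) i := fun n i =>
    (measurable_piv d δ α i).comp
      (@measurable_pi_lambda _ _ _ (ℱ n) _ _ fun k => measurable_occ hY n k)
  have hindi : ∀ n i, Integrable (fun ω => if X n ω = i then (1 : ℝ) else 0) P := fun n i =>
    .of_bound ((hind hX n i).mono (ℱ.le n) le_rfl).aestronglyMeasurable 1
      (ae_of_all _ fun ω => by split_ifs <;> simp)
  have hmi : ∀ n i j, Integrable (fun ω => (if X n ω = i then (1 : ℝ) else 0) *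
      (if Y n ω = j then (1 : ℝ) else 0)) P := fun n i j =>
    .of_bound (((hind hX n i).mul (hind hY n j)).mono (ℱ.le n) le_rfl).aestronglyMeasurable 1
      (ae_of_all _ fun ω => by split_ifs <;> simp)
  have hpi : ∀ n i, Integrable (fun ω => piv d δ α (occ d Y n ω) i) P := fun n i =>
    .of_bound ((hpm n i).mono (ℱ.le n) le_rfl).aestronglyMeasurable 1
      (ae_of_all _ fun ω => by
        rw [Real.norm_of_nonneg (piv_nonneg hδ _ _ _)]
        exact piv_le_one hδ _ _ _)
  have hce : ∀ n i, P[fun ω => if X (n + 1) ω = i then (1 : ℝ) else 0 | ℱ n] =ᵐ[P]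
      fun ω => piv d δ α (occ d Y n ω) i := by
    intro n i
    have h1 : (fun ω => if X (n + 1) ω = i then (1 : ℝ) else 0) =
        ∑ j, fun ω => (if X (n + 1) ω = i then (1 : ℝ) else 0) *
          (if Y (n + 1) ω = j then (1 : ℝ) else 0) := by
      ext ω
      simp
    rw [h1]
    filter_upwards [condExp_finsetSum (μ := P) (s := Finset.univ)
      (fun j _ => hmi (n + 1) i j) (ℱ n), ae_all_iff.2 (hcond n i)] with ω h2 h3
    rw [h2, Finset.sum_apply, Finset.sum_congr rfl fun j _ => h3 j, ← Finset.mul_sum,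
      sum_piv hδ, mul_one]
  have key : ∀ i, ∀ᵐ ω ∂P, ∃ m, Tendsto (fun n => ∑ k ∈ range n,
      1 / (((k + 1 : ℕ) : ℝ) + d) * ((if X (k + 1) ω = i then (1 : ℝ) else 0) -
        piv d δ α (occ d Y k ω) i)) atTop (nhds m) := by
    intro i
    refine ae_exists_tendsto_sum_mul_of_condExp_eq_zero (ℱ := ℱ) (summable_sq_one_div_add d)
      (U := fun k ω => (if X (k + 1) ω = i then (1 : ℝ) else 0) - piv d δ α (occ d Y k ω) i)
      (fun n => ((hind hX (n + 1) i).sub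
        ((hpm n i).mono (ℱ.mono n.le_succ) le_rfl)).stronglyMeasurable) (fun n ω => ?_)
      fun n => ?_
    · have h1 := piv_nonneg hδ α (occ d Y n ω) i
      have h2 := piv_le_one hδ α (occ d Y n ω) i
      rw [abs_le]
      split_ifs <;> constructor <;> linarith
    · have h1 := condExp_of_stronglyMeasurable (ℱ.le n) (hpm n i).stronglyMeasurable (hpi n i)
      filter_upwards [condExp_sub (hindi (n + 1) i) (hpi n i) (ℱ n), hce n i] with ω h2 h3
      refine Eq.trans h2 ?_
      rw [Pi.sub_apply, h1, h3]
      simp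
  filter_upwards [ae_all_iff.2 key] with ω hω
  choose m hm using hω
  exact ⟨m, tendsto_pi_nhds.2 hm⟩

/-- Lemma `bridge`: almost surely, the interpolated process `z̄` of the
two-particle vertex-reinforced interacting random walk is an asymptotic pseudotrajectory
of any semiflow `Φ` of `F`: for every `T > 0`,
`lim_{t→∞} sup_{0 ≤ h ≤ T} ‖z̄(t+h) − Φ_h(z̄(t))‖₁ = 0`. -/
theorem stmt_6 (d : ℕ) (hd : 2 ≤ d) (δ : ℝ) (hδ : 0 < δ) (α : ℝ) (hα : 0 < α)
    (Φ : ℝ → ((Fin d → ℝ) × (Fin d → ℝ)) → ((Fin d → ℝ) × (Fin d → ℝ)))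
    (hΦ : IsSemiflow d δ α Φ)
    (Ω : Type) (mΩ : MeasurableSpace Ω) (P : Measure Ω) (hP : IsProbabilityMeasure P)
    (ℱ : Filtration ℕ mΩ) (X Y : ℕ → Ω → Fin d)
    (hX : ∀ n, Measurable[ℱ n] (X n))
    (hY : ∀ n, Measurable[ℱ n] (Y n))
    (hcond : ∀ (n : ℕ) (i j : Fin d),
      (P[(fun ω => (if X (n + 1) ω = i then (1 : ℝ) else 0) *
            (if Y (n + 1) ω = j then (1 : ℝ) else 0)) | ℱ n]) =ᵐ[P]
        fun ω => piv d δ α (occ d Y n ω) i * piv d δ α (occ d X n ω) j) :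
    ∀ᵐ ω ∂P, ∀ zbar : ℝ → (Fin d → ℝ) × (Fin d → ℝ),
      (∀ n : ℕ, ∀ t ∈ Set.Icc (tau d n) (tau d (n + 1)),
        zbar t = ((occ d X n ω, occ d Y n ω) : (Fin d → ℝ) × (Fin d → ℝ)) +
          ((t - tau d n) / (tau d (n + 1) - tau d n)) •
            (((occ d X (n + 1) ω, occ d Y (n + 1) ω) : (Fin d → ℝ) × (Fin d → ℝ)) -
              (occ d X n ω, occ d Y n ω))) →
      ∀ T : ℝ, 0 < T →
        Tendsto (fun t : ℝ => ⨆ h : Set.Icc (0 : ℝ) T,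
            norm1 (zbar (t + (h : ℝ)) - Φ (h : ℝ) (zbar t)))
          atTop (nhds 0) := by
  have : NeZero d := ⟨by omega⟩
  filter_upwards [ae_exists_tendsto_noise hδ hX hY hcond,
    ae_exists_tendsto_noise hδ hY hX fun n i j => by
      simpa only [mul_comm] using hcond n j i] with ω hMX hMY zbar hzbar T hT
  obtain ⟨mX, hmX⟩ := hMX
  obtain ⟨mY, hmY⟩ := hMY
  have hd0 : (0 : ℝ) < d := Nat.cast_pos.2 (NeZero.pos d)
  have hτ := strictMono_tau d
  have hτ' := tendsto_tau d
  have hinterp : IsAffineInterpolation (tau d)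
      (fun n => ((occ d X n ω, occ d Y n ω) : (Fin d → ℝ) × (Fin d → ℝ))) zbar := hzbar
  have hincr : ∀ (Z : ℕ → Ω → Fin d) (n : ℕ),
      ‖occ d Z (n + 1) ω - occ d Z n ω‖ ≤ 1 / (((n + 1 : ℕ) : ℝ) + d) := by
    intro Z n
    refine (pi_norm_le_iff_of_nonneg (by positivity)).2 fun i => ?_
    have h0 := (occ_mem_simplexSet Z n ω).1 i
    have h1 := le_one_of_mem_simplexSet (occ_mem_simplexSet Z n ω) i
    rw [Pi.sub_apply, occ_succ_sub, norm_mul, Real.norm_of_nonneg (by positivity)]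
    refine mul_le_of_le_one_right (by positivity) (abs_le.2 ?_)
    split_ifs <;> constructor <;> linarith
  have hz : Tendsto (fun n => ((occ d X (n + 1) ω, occ d Y (n + 1) ω) :
      (Fin d → ℝ) × (Fin d → ℝ)) - (occ d X n ω, occ d Y n ω)) atTop (nhds 0) :=
    squeeze_zero_norm (fun n => norm_prod_le_iff.2 ⟨hincr X n, hincr Y n⟩)
      (tendsto_one_div_add d)
  have hmem : ∀ t ≥ tau d 0, zbar t ∈ Dset d := fun t ht =>
    hinterp.mem_of_convex hτ hτ' (convex_Dset d)
      (fun n _ => ⟨occ_mem_simplexSet X n ω, occ_mem_simplexSet Y n ω⟩) ht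
  rw [Metric.tendsto_atTop]
  intro ε hε
  have htraj := exists_forall_norm_sub_trajectory_le hτ hτ' (T := T)
    (ε := ε / 2 / (2 * d)) (lipschitzWith_Fvec (d := d) hδ hα) (fun n => by
      ext i <;>
      · simp only [Prod.fst_sub, Prod.snd_sub, Prod.fst_add, Prod.snd_add, Prod.smul_fst,
          Prod.smul_snd, Pi.sub_apply, Pi.add_apply, Pi.smul_apply, Pi.neg_apply, Fvec,
          smul_eq_mul, occ_succ_sub, tau_succ_sub, Finset.sum_range_succ]
        ring) hz (hmX.prodMk_nhds hmY) hinterp (by positivity)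
  obtain ⟨t₀, ht₀⟩ := htraj
  refine ⟨max t₀ (tau d 0), fun t ht => ?_⟩
  have hzt := hmem t ((le_max_right _ _).trans ht)
  obtain ⟨-, hΦ0, -, -, hΦ'⟩ := hΦ
  have hbound : ∀ h : Set.Icc (0 : ℝ) T,
      norm1 (zbar (t + (h : ℝ)) - Φ (h : ℝ) (zbar t)) ≤ ε / 2 := fun h => by
    refine (norm1_le _).trans ?_
    rw [mul_comm, ← le_div_iff₀ (by positivity)]
    exact ht₀ t ((le_max_left _ _).trans ht) (fun s => Φ s (zbar t)) (hΦ0 _ hzt)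
      (fun s hs => ((hΦ' _ hzt s hs.1).continuousWithinAt).mono Set.Icc_subset_Ici_self)
      (fun s hs => (hΦ' _ hzt s hs.1).mono (Set.Ici_subset_Ici.2 hs.1)) h h.2
  rw [Real.dist_0_eq_abs, abs_of_nonneg (Real.iSup_nonneg fun _ => norm1_nonneg _)]
  exact (Real.iSup_le hbound (by positivity)).trans_lt (half_lt_self hε)
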